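/- arXiv:2206.11158 — 2 statements merged into one kernel-verified Lean document; each statement's English description precedes it below -/
import Mathlib

section
/- Let N be a positive integer and a : ℤ → ℝ with a_j = 0 for j ≤ 0 or j > N, and f(x) = Σ_{j=1}^N a_j rect(x − j). Let k ≥ 1 be an integer, t a real with k < t ≤ k + 1, n an integer, and s a real with 0 ≤ s ≤ t − k; set u = n − 1/2 + t/2 − s (so the window [u − t/2, u + t/2] equals [n − 1/2 − s, n − 1/2 + t − s]). Then ⟨f, G_{(t,0,u)}⟩ = (1/√t)·(a_{n−1}·s + Σ_{j=n}^{n+k−1} a_j + a_{n+k}·(t − s − k)). -/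
open MeasureTheory Real Set

/-- `rect` is the indicator function of the interval `[-1/2, 1/2]`. -/
noncomputable def rect (x : ℝ) : ℝ := if x ∈ Set.Icc (-(1:ℝ)/2) (1/2) then 1 else 0

/-- The time-frequency atom `G_(t,ξ,u)(x) = (1/√t) rect((x-u)/t) e^{2πiξx}`. -/
noncomputable def atom (t ξ u : ℝ) (x : ℝ) : ℂ :=
  ((1 / Real.sqrt t : ℝ) : ℂ) * ((rect ((x - u) / t) : ℝ) : ℂ) *
    Complex.exp (2 * Real.pi * Complex.I * ξ * x)

/-- `⟨f, G_γ⟩ = ∫ f(x) G_γ(x) dx`. -/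
noncomputable def ip (f : ℝ → ℝ) (t ξ u : ℝ) : ℂ := ∫ x : ℝ, (f x : ℂ) * atom t ξ u x

/-- The step function `f(x) = Σ_{j=1}^N a_j rect(x - j)`. -/
noncomputable def stepFun (N : ℕ) (a : ℕ → ℝ) (x : ℝ) : ℝ :=
  ∑ j ∈ Finset.Icc 1 N, a j * rect (x - j)

/-- The step function with integer-indexed coefficients (extended by zero outside
`{1, …, N}`). -/
noncomputable def stepFunZ (N : ℕ) (a : ℤ → ℝ) (x : ℝ) : ℝ :=
  ∑ j ∈ Finset.Icc (1 : ℤ) (N : ℤ), a j * rect (x - (j : ℝ))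

theorem rect_sub_mul_rect_div {t : ℝ} (ht : 0 < t) (c u x : ℝ) :
    rect (x - c) * rect ((x - u) / t) =
      (Icc (max (c - 1/2) (u - t/2)) (min (c + 1/2) (u + t/2))).indicator 1 x := by
  have h₁ : x - c ∈ Icc (-(1:ℝ)/2) (1/2) ↔ c - 1/2 ≤ x ∧ x ≤ c + 1/2 := by
    constructor <;> rintro ⟨h, h'⟩ <;> constructor <;> linarith
  have h₂ : (x - u) / t ∈ Icc (-(1:ℝ)/2) (1/2) ↔ u - t/2 ≤ x ∧ x ≤ u + t/2 := by
    rw [mem_Icc, le_div_iff₀ ht, div_le_iff₀ ht]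
    constructor <;> rintro ⟨h, h'⟩ <;> constructor <;> linarith
  simp only [rect, h₁, h₂, indicator_apply, mem_Icc, max_le_iff, le_min_iff, Pi.one_apply]
  grind

theorem integrable_rect_sub_mul_rect_div {t : ℝ} (ht : 0 < t) (c u : ℝ) :
    Integrable fun x => rect (x - c) * rect ((x - u) / t) := by
  simp_rw [rect_sub_mul_rect_div ht]
  exact IntegrableOn.integrable_indicator (integrableOn_const (by simp)) measurableSet_Icc

/-- The overlap of a unit cell with a window, as an integral. -/
theorem integral_rect_sub_mul_rect_div {t : ℝ} (ht : 0 < t) (c u : ℝ) :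
    ∫ x, rect (x - c) * rect ((x - u) / t) =
      max (min (c + 1/2) (u + t/2) - max (c - 1/2) (u - t/2)) 0 := by
  simp_rw [rect_sub_mul_rect_div ht]
  rw [integral_indicator_one measurableSet_Icc, Real.volume_real_Icc]

theorem ip_stepFunZ_zero (N : ℕ) (a : ℤ → ℝ) {t : ℝ} (ht : 0 < t) (u : ℝ) :
    ip (stepFunZ N a) t 0 u =
      ((1 / √t * ∑ j ∈ Finset.Icc (1 : ℤ) N,
        a j * max (min ((j : ℝ) + 1/2) (u + t/2) - max ((j : ℝ) - 1/2) (u - t/2)) 0 : ℝ) : ℂ) := by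
  have h : ∀ x : ℝ, (stepFunZ N a x : ℂ) * atom t 0 u x =
      ((1 / √t * ∑ j ∈ Finset.Icc (1 : ℤ) N,
        a j * (rect (x - j) * rect ((x - u) / t)) : ℝ) : ℂ) := by
    intro x
    simp_rw [← mul_assoc (a _), ← Finset.sum_mul]
    simp only [atom, stepFunZ, Complex.ofReal_zero, mul_zero, zero_mul, Complex.exp_zero,
      Complex.ofReal_mul]
    ring
  simp_rw [ip, h, integral_complex_ofReal, integral_const_mul]
  rw [integral_finsetSum _ fun j _ => (integrable_rect_sub_mul_rect_div ht _ _).const_mul _]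
  simp_rw [integral_const_mul, integral_rect_sub_mul_rect_div ht]

/-- For `k < t ≤ k + 1` (integer `k ≥ 1`), window `[n − 1/2 − s, n − 1/2 + t − s]`
with `0 ≤ s ≤ t − k`, the zero-modulation inner product is
`⟨f, G_(t,0,u)⟩ = (1/√t)·(a_{n−1}·s + Σ_{j=n}^{n+k−1} a_j + a_{n+k}·(t − s − k))`. -/
theorem statement9 (N : ℕ) (hN : 0 < N) (a : ℤ → ℝ)
    (ha : ∀ j : ℤ, (j ≤ 0 ∨ (N : ℤ) < j) → a j = 0)
    (k : ℕ) (hk : 1 ≤ k) (t : ℝ) (ht1 : (k : ℝ) < t) (ht2 : t ≤ (k : ℝ) + 1)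
    (n : ℤ) (s : ℝ) (hs : 0 ≤ s) (hst : s ≤ t - (k : ℝ)) :
    ip (stepFunZ N a) t 0 ((n : ℝ) - 1/2 + t/2 - s) =
      (((1 / Real.sqrt t) * (a (n - 1) * s + (∑ j ∈ Finset.Icc n (n + (k : ℤ) - 1), a j) +
          a (n + (k : ℤ)) * (t - s - (k : ℝ))) : ℝ) : ℂ) := by
  have hk' : (1 : ℝ) ≤ k := by exact_mod_cast hk
  rw [ip_stepFunZ_zero N a (by linarith)]
  congr 2
  set w : ℤ → ℝ := fun j => max (min ((j : ℝ) + 1/2) ((n : ℝ) - 1/2 + t/2 - s + t/2) -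
    max ((j : ℝ) - 1/2) ((n : ℝ) - 1/2 + t/2 - s - t/2)) 0 with hw
  have w_left : w (n - 1) = s := by
    simp only [hw]
    push_cast
    rw [min_eq_left (by linarith), max_eq_right (a := (n : ℝ) - 1 - 1/2) (by linarith),
      max_eq_left (by linarith)]
    ring
  have w_right : w (n + k) = t - s - k := by
    simp only [hw]
    push_cast
    rw [min_eq_right (by linarith), max_eq_left (b := (n : ℝ) - 1/2 + t/2 - s - t/2) (by linarith),
      max_eq_left (by linarith)]
    ring
  have w_mid : ∀ j ∈ Finset.Icc n (n + (k : ℤ) - 1), w j = 1 := by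
    intro j hj
    rw [Finset.mem_Icc] at hj
    have h₁ : (n : ℝ) ≤ j := by exact_mod_cast hj.1
    have h₂ : (j : ℝ) ≤ n + k - 1 := by exact_mod_cast hj.2
    simp only [hw]
    rw [min_eq_left (by linarith), max_eq_left (b := (n : ℝ) - 1/2 + t/2 - s - t/2) (by linarith),
      max_eq_left (by linarith)]
    ring
  have w_out : ∀ j ∉ Finset.Icc (n - 1) (n + (k : ℤ)), w j = 0 := by
    intro j hj
    rw [Finset.mem_Icc, not_and_or, not_le, not_le] at hj
    refine max_eq_right (sub_nonpos.2 ?_)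
    rcases hj with hj | hj
    · have h : (j : ℝ) + 1 ≤ n - 1 := by exact_mod_cast hj
      exact (min_le_left _ _).trans (le_trans (by linarith) (le_max_right _ _))
    · have h : (n : ℝ) + k + 1 ≤ j := by exact_mod_cast hj
      exact (min_le_right _ _).trans (le_trans (by linarith) (le_max_left _ _))
  have hsum : ∑ j ∈ Finset.Icc (1 : ℤ) N, a j * w j =
      ∑ j ∈ Finset.Icc (n - 1) (n + (k : ℤ)), a j * w j := by
    rw [Finset.sum_subset (Finset.subset_union_left (s₂ := Finset.Icc (n - 1) (n + (k : ℤ)))),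
      ← Finset.sum_subset Finset.subset_union_right]
    · intro j _ hj
      rw [w_out j hj, mul_zero]
    · intro j _ hj
      rw [Finset.mem_Icc] at hj
      rw [ha j (by omega), zero_mul]
  have hsplit : Finset.Icc (n - 1) (n + (k : ℤ)) =
      insert (n - 1) (insert (n + (k : ℤ)) (Finset.Icc n (n + (k : ℤ) - 1))) := by
    ext j
    simp only [Finset.mem_insert, Finset.mem_Icc]
    omega
  rw [hsum, hsplit, Finset.sum_insert (by simp; omega), Finset.sum_insert (by simp), w_left,
    w_right, Finset.sum_congr rfl fun j hj => by rw [w_mid j hj, mul_one]]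
  ring
end

section
/- Let N be a positive integer, a_1, …, a_N a real sequence, and f(x) = Σ_{j=1}^N a_j rect(x − j). Then for all integers n ≥ 1 and k ≥ 0 with n + k ≤ N, ⟨f, G_{(k+1, 0, n + k/2)}⟩ = (Σ_{j=n}^{n+k} a_j) / √(k + 1); that is, the wavelet atom of integer scale k+1 whose window is exactly [n − 1/2, n + k + 1/2] picks out the scaled consecutive sum of the sequence. -/
open MeasureTheory Real Set

lemma rect_sub_div_eq_indicator {t : ℝ} (ht : 0 < t) (u x : ℝ) :
    rect ((x - u) / t) = (Icc (u - t / 2) (u + t / 2)).indicator 1 x := by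
  have hmem : (x - u) / t ∈ Icc (-(1 : ℝ) / 2) (1 / 2) ↔ x ∈ Icc (u - t / 2) (u + t / 2) := by
    simp only [mem_Icc, le_div_iff₀ ht, div_le_iff₀ ht]
    constructor <;> rintro ⟨h₁, h₂⟩ <;> constructor <;> linarith
  simp only [rect, hmem, indicator_apply, Pi.one_apply]

lemma rect_sub_mul_rect_sub_div_eq_indicator {t : ℝ} (ht : 0 < t) (c u : ℝ) :
    (fun x ↦ rect (x - c) * rect ((x - u) / t)) =
      (Icc (max (c - 1 / 2) (u - t / 2)) (min (c + 1 / 2) (u + t / 2))).indicator 1 := by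
  funext x
  have hc : rect (x - c) = (Icc (c - 1 / 2) (c + 1 / 2)).indicator 1 x := by
    simpa using rect_sub_div_eq_indicator one_pos c x
  rw [hc, rect_sub_div_eq_indicator ht, ← Icc_inter_Icc, inter_indicator_one, Pi.mul_apply]

lemma integrable_rect_sub_mul_rect_sub_div {t : ℝ} (ht : 0 < t) (c u : ℝ) :
    Integrable (fun x ↦ rect (x - c) * rect ((x - u) / t)) := by
  rw [rect_sub_mul_rect_sub_div_eq_indicator ht, integrable_indicator_iff measurableSet_Icc]
  exact integrableOn_const measure_Icc_lt_top.ne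

lemma integral_rect_sub_mul_rect_sub_div {t : ℝ} (ht : 0 < t) (c u : ℝ) :
    ∫ x, rect (x - c) * rect ((x - u) / t) =
      max (min (c + 1 / 2) (u + t / 2) - max (c - 1 / 2) (u - t / 2)) 0 := by
  rw [rect_sub_mul_rect_sub_div_eq_indicator ht, integral_indicator_one measurableSet_Icc,
    measureReal_def, Real.volume_Icc, ENNReal.toReal_ofReal']

/-- The window `[n - 1/2, n + k + 1/2]` meets the cell of `j` in the whole cell or in a null set. -/
lemma integral_rect_sub_natCast_mul_rect_window (n k j : ℕ) :
    ∫ x, rect (x - j) * rect ((x - ((n : ℝ) + (k : ℝ) / 2)) / ((k : ℝ) + 1)) =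
      if j ∈ Finset.Icc n (n + k) then 1 else 0 := by
  rw [integral_rect_sub_mul_rect_sub_div (by positivity)]
  split_ifs with hj
  · obtain ⟨h₁, h₂⟩ := Finset.mem_Icc.1 hj
    have h₁' : (n : ℝ) ≤ j := by exact_mod_cast h₁
    have h₂' : (j : ℝ) ≤ n + k := by exact_mod_cast h₂
    rw [min_eq_left (by linarith), max_eq_left (a := (j : ℝ) - 1 / 2) (by linarith)]
    norm_num
  · apply max_eq_right
    rcases lt_or_ge j n with h | h
    · have h' : (j : ℝ) + 1 ≤ n := by exact_mod_cast h
      linarith [min_le_left ((j : ℝ) + 1 / 2) (n + k / 2 + (k + 1) / 2),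
        le_max_right ((j : ℝ) - 1 / 2) (n + k / 2 - (k + 1) / 2)]
    · have h' : (n : ℝ) + k + 1 ≤ j := by
        have : n + k + 1 ≤ j := by
          rw [Finset.mem_Icc] at hj
          lia
        exact_mod_cast this
      linarith [min_le_right ((j : ℝ) + 1 / 2) (n + k / 2 + (k + 1) / 2),
        le_max_left ((j : ℝ) - 1 / 2) (n + k / 2 - (k + 1) / 2)]

lemma ip_zero_frequency (f : ℝ → ℝ) (t u : ℝ) :
    ip f t 0 u = (((∫ x, f x * rect ((x - u) / t)) / Real.sqrt t : ℝ) : ℂ) := by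
  rw [ip, ← integral_div, ← integral_complex_ofReal]
  congr 1 with x
  simp only [atom, Complex.ofReal_zero, mul_zero, zero_mul, Complex.exp_zero, mul_one]
  push_cast
  ring

/-- The wavelet atom of integer scale `k + 1` whose window is exactly
`[n − 1/2, n + k + 1/2]` picks out the scaled consecutive sum:
`⟨f, G_(k+1, 0, n + k/2)⟩ = (Σ_{j=n}^{n+k} a_j) / √(k+1)`. -/
theorem statement11 (N : ℕ) (hN : 0 < N) (a : ℕ → ℝ) (n k : ℕ)
    (hn : 1 ≤ n) (hnk : n + k ≤ N) :
    ip (stepFun N a) ((k : ℝ) + 1) 0 ((n : ℝ) + (k : ℝ) / 2) =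
      (((∑ j ∈ Finset.Icc n (n + k), a j) / Real.sqrt ((k : ℝ) + 1) : ℝ) : ℂ) := by
  rw [ip_zero_frequency]
  congr 2
  simp only [stepFun, Finset.sum_mul, mul_assoc]
  rw [integral_finsetSum _ fun j _ ↦
    (integrable_rect_sub_mul_rect_sub_div (by positivity) _ _).const_mul _]
  simp only [integral_const_mul, integral_rect_sub_natCast_mul_rect_window, mul_ite, mul_one,
    mul_zero]
  rw [Finset.sum_ite_mem, Finset.inter_eq_right.2 (Finset.Icc_subset_Icc hn hnk)]
end
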